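/- arXiv:math/0305393 — 3 statements merged into one kernel-verified Lean document; each statement's English description precedes it below -/
import Mathlib

section
/- Let k ≥ 0 with k+1 ≤ n, let w be a permutation of {1,…,n}, and let π be a permutation of {1,…,n} that fixes every point larger than k+1 (i.e. π lies in the copy of S_{k+1} inside S_n). Then for every index i ≤ n, i ∈ Del_{k+1}(w) if and only if i ∈ Del_{k+1}(πw); in particular #Del_{k+1}(w) = #Del_{k+1}(πw). -/
open Finset

/-- The Coxeter generator `s_j = (j, j+1)` of the symmetric group on `{1,…,m}`,
viewed as a permutation of `ℕ` (with 1-based positions). -/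
def sgen (j : ℕ) : Equiv.Perm ℕ := Equiv.swap j (j + 1)

/-- The permutation determined by a word in the Coxeter generators,
letters read from left to right and composed as functions. -/
def wordPerm (L : List ℕ) : Equiv.Perm ℕ := (L.map sgen).prod

/-- The canonical presentation of a permutation of `{1,…,m}` (given as a permutation of `ℕ`
supported on `{1,…,m}`): the unique factorization `w = w₁ w₂ ⋯ w_{m-1}` with
`w_j ∈ R_j = {1, s_j, s_j s_{j-1}, …, s_j ⋯ s_1}`, recorded as the list of indices of the
Coxeter generators appearing, read from left to right. -/
def canonWord : ℕ → Equiv.Perm ℕ → List ℕ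
  | 0, _ => []
  | m + 1, π =>
      canonWord m
          (π * (wordPerm ((List.range' (π⁻¹ (m + 1)) (m + 1 - π⁻¹ (m + 1))).reverse))⁻¹)
        ++ (List.range' (π⁻¹ (m + 1)) (m + 1 - π⁻¹ (m + 1))).reverse

def finIccEquiv (m : ℕ) : Fin m ≃ {i : ℕ // i ∈ Finset.Icc 1 m} where
  toFun a := ⟨a.1 + 1, by have := a.isLt; simp only [Finset.mem_Icc]; omega⟩
  invFun b := ⟨b.1 - 1, by have := b.2; simp only [Finset.mem_Icc] at this; omega⟩
  left_inv a := by ext; simp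
  right_inv b := by
    have := b.2
    simp only [Finset.mem_Icc] at this
    ext
    simp only []
    omega

/-- A permutation of `{1,…,m}`, i.e. of `Fin m`, viewed as a permutation of `ℕ`
(moving only the points `1,…,m`, with `i ∈ Fin m` corresponding to the point `i+1`). -/
def natPerm {m : ℕ} (π : Equiv.Perm (Fin m)) : Equiv.Perm ℕ :=
  π.extendDomain (finIccEquiv m)

/-- `Del_q` of a permutation of `{1,…,m}`: the set of positions `q+1 ≤ i ≤ m` that are
`(q-1)`-st almost left-to-right minima, i.e. `#{j < i : π(j) < π(i)} ≤ q - 1`. -/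
def DelQ (q m : ℕ) (π : Equiv.Perm ℕ) : Finset ℕ :=
  (Finset.Icc (q + 1) m).filter fun i =>
    ((Finset.Ico 1 i).filter fun j => π j < π i).card ≤ q - 1

/-- The descent set of a permutation of `{1,…,m}`: positions `1 ≤ i ≤ m-1` with `π(i) > π(i+1)`. -/
def DesSet (m : ℕ) (π : Equiv.Perm ℕ) : Finset ℕ :=
  (Finset.Icc 1 (m - 1)).filter fun i => π (i + 1) < π i

/-- `Des_q(π) = (Des(π) ∩ {q,…,m-1}) ∪ (Del_q(π) - 1)`. -/
def DesQ (q m : ℕ) (π : Equiv.Perm ℕ) : Finset ℕ :=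
  DesSet m π ∩ Finset.Icc q (m - 1) ∪ (DelQ q m π).image (fun i => i - 1)

/-- The `q`-inversion number of a permutation of `{1,…,m}`:
`inv_q(π) = Σ_{i=q+1}^m min(i-q, #{j < i : π(j) > π(i)})`. -/
def invQ (q m : ℕ) (π : Equiv.Perm ℕ) : ℕ :=
  ∑ i ∈ Finset.Icc (q + 1) m,
    min (i - q) ((Finset.Ico 1 i).filter fun j => π i < π j).card

/-- The `q`-reverse major index `rmaj_{q,m}(π) = Σ_{i ∈ Des_q(π)} (m - i)`. -/
def rmajQ (q m : ℕ) (π : Equiv.Perm ℕ) : ℕ :=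
  ∑ i ∈ DesQ q m π, (m - i)

/-- The `q`-length of a permutation of `{1,…,m}`: the number of letters in the canonical
presentation, where the generators `s_1, …, s_{q-1}` are not counted. -/
def ellQ (q m : ℕ) (π : Equiv.Perm ℕ) : ℕ :=
  ((canonWord m π).filter fun j => q ≤ j).length

/-- `del_q` of a permutation of `{1,…,m}`: the number of occurrences of the generator `s_q`
in the canonical presentation. -/
def delq (q m : ℕ) (π : Equiv.Perm ℕ) : ℕ := (canonWord m π).count q

/-- The covering map `f_q : S_m → S_{m-q+1}`, defined on the canonical presentation by
`s_j ↦ 1` if `j ≤ q-1` and `s_j ↦ s_{j-q+1}` if `j ≥ q`. -/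
def fq (q m : ℕ) (π : Equiv.Perm ℕ) : Equiv.Perm ℕ :=
  wordPerm (((canonWord m π).filter fun j => q ≤ j).map fun j => j - q + 1)

/-- A permutation of `{1,…,m}` avoids the pattern set `Pat(q)` iff there is no sequence
`1 ≤ i₁ < i₂ < ⋯ < i_{q+1} < m` with `π(i_{q+1}) > π(i_{q+1}+1)` and
`π(i_j) < π(i_{q+1}+1)` for all `1 ≤ j ≤ q`. -/
def AvoidsPat (q m : ℕ) (π : Equiv.Perm ℕ) : Prop :=
  ¬ ∃ f : Fin (q + 1) → ℕ, StrictMono f ∧ 1 ≤ f 0 ∧ f (Fin.last q) < m ∧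
      π (f (Fin.last q) + 1) < π (f (Fin.last q)) ∧
      ∀ a : Fin (q + 1), a ≠ Fin.last q → π (f a) < π (f (Fin.last q) + 1)

/-- The Stirling number of the second kind `S(n,k)`: the number of partitions of
`{1,…,n}` into `k` nonempty blocks. -/
noncomputable def stirling2 (n k : ℕ) : ℕ :=
  Nat.card {P : Finpartition (Finset.univ : Finset (Fin n)) // P.parts.card = k}

/-- The `q`-Bell number `b_q(n) = Σ_k q^k S(n,k)`. -/
noncomputable def qBell (q n : ℕ) : ℕ := ∑ k ∈ Finset.range (n + 1), q ^ k * stirling2 n k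

/-- `h_q(m)`: the number of permutations of `{1,…,m}` avoiding all patterns in `Pat(q)`. -/
noncomputable def hq (q m : ℕ) : ℕ :=
  Nat.card {π : Equiv.Perm (Fin m) // AvoidsPat q m (natPerm π)}

/-- The number of cycles (including fixed points) of a permutation of `{1,…,n}`. -/
def cycleCount {n : ℕ} (σ : Equiv.Perm (Fin n)) : ℕ :=
  σ.cycleType.card + (n - σ.support.card)

/-- The signless Stirling number of the first kind `c(n,k)`: the number of permutations
of `{1,…,n}` with exactly `k` cycles. -/
noncomputable def stirling1 (n k : ℕ) : ℕ :=
  Nat.card {σ : Equiv.Perm (Fin n) // cycleCount σ = k}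

theorem natPerm_zero {m : ℕ} (π : Equiv.Perm (Fin m)) : natPerm π 0 = 0 :=
  Equiv.Perm.extendDomain_apply_not_subtype π (finIccEquiv m) (by simp)

theorem natPerm_mul {m : ℕ} (π w : Equiv.Perm (Fin m)) :
    natPerm (π * w) = natPerm π * natPerm w :=
  (Equiv.Perm.extendDomain_mul (finIccEquiv m) π w).symm

theorem card_filter_lt_le_of_apply_le {σ : Equiv.Perm ℕ} (h0 : σ 0 = 0) {k i : ℕ}
    (hi : σ i ≤ k + 1) : ((Finset.Ico 1 i).filter fun j => σ j < σ i).card ≤ k := by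
  calc _ ≤ (Finset.Icc 1 k).card := by
        refine Finset.card_le_card_of_injOn σ (fun j hj => ?_) σ.injective.injOn
        simp only [Finset.coe_filter, Finset.mem_Ico, Set.mem_ofPred_eq] at hj
        have hj0 : σ j ≠ 0 := fun h => by
          have := σ.injective (h.trans h0.symm)
          omega
        simp only [Finset.coe_Icc, Set.mem_Icc]
        omega
    _ = k := by simp

theorem apply_le_of_fixed_above {τ : Equiv.Perm ℕ} {b : ℕ} (h : ∀ i, b < i → τ i = i)
    {x : ℕ} (hx : x ≤ b) : τ x ≤ b := by
  by_contra! hlt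
  have := τ.injective (h _ hlt)
  omega

theorem DelQ_mul_left_of_fixed_above {σ τ : Equiv.Perm ℕ} (hσ : σ 0 = 0) (hτ0 : τ 0 = 0)
    {k : ℕ} (hτ : ∀ i, k + 1 < i → τ i = i) (n : ℕ) :
    DelQ (k + 1) n (τ * σ) = DelQ (k + 1) n σ := by
  refine Finset.filter_congr fun i _ => ?_
  rw [Nat.add_sub_cancel]
  rcases le_or_gt (σ i) (k + 1) with hi | hi
  · have hτσ : (τ * σ) 0 = 0 := by simp [hσ, hτ0]
    exact iff_of_true
      (card_filter_lt_le_of_apply_le hτσ (apply_le_of_fixed_above hτ hi))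
      (card_filter_lt_le_of_apply_le hσ hi)
  · have hlt : ∀ j, (τ * σ) j < (τ * σ) i ↔ σ j < σ i := fun j => by
      simp only [Equiv.Perm.mul_apply, hτ _ hi]
      rcases le_or_gt (σ j) (k + 1) with hj | hj
      · have := apply_le_of_fixed_above hτ hj
        omega
      · rw [hτ _ hj]
    simp only [hlt]

/-- Let `k ≥ 0` with `k+1 ≤ n`, let `w` be a permutation of `{1,…,n}`, and
let `π` be a permutation of `{1,…,n}` fixing every point larger than `k+1` (i.e. `π` lies in
the copy of `S_{k+1}` inside `S_n`). Then for every index `i ≤ n`, `i ∈ Del_{k+1}(w)` iff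
`i ∈ Del_{k+1}(πw)`; in particular `#Del_{k+1}(w) = #Del_{k+1}(πw)`. -/
theorem del_invariant_left_mul (n k : ℕ) (hk : k + 1 ≤ n) (w π : Equiv.Perm (Fin n))
    (hπ : ∀ i : ℕ, k + 1 < i → natPerm π i = i) :
    (∀ i : ℕ, i ≤ n →
      (i ∈ DelQ (k + 1) n (natPerm w) ↔ i ∈ DelQ (k + 1) n (natPerm (π * w)))) ∧
    (DelQ (k + 1) n (natPerm w)).card = (DelQ (k + 1) n (natPerm (π * w))).card := by
  have h : DelQ (k + 1) n (natPerm (π * w)) = DelQ (k + 1) n (natPerm w) := by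
    rw [natPerm_mul]
    exact DelQ_mul_left_of_fixed_above (natPerm_zero w) (natPerm_zero π) hπ n
  exact ⟨fun i _ => by rw [h], by rw [h]⟩
end

section
/- For every positive integer q and every permutation π of {1,…,n+q−1}, the number of a^{q−1}.l.t.r.min of π equals the number of a^{q−1}.l.t.r.min of π⁻¹: #Del_q(π) = #Del_q(π⁻¹). -/
open Finset

/-- A permutation preserving `{1,…,m}` maps the points south-west of `(i, σ i)` in the graph of `σ`
bijectively to the points south-west of `(σ i, i)` in the graph of `σ⁻¹`. -/
theorem card_filter_lt_inv {m : ℕ} {σ : Equiv.Perm ℕ}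
    (hσ : ∀ i, σ i ∈ Finset.Icc 1 m ↔ i ∈ Finset.Icc 1 m) {i : ℕ} (hi : i ∈ Finset.Icc 1 m) :
    ((Finset.Ico 1 (σ i)).filter fun k => σ⁻¹ k < σ⁻¹ (σ i)).card =
      ((Finset.Ico 1 i).filter fun j => σ j < σ i).card := by
  symm
  refine Finset.card_equiv σ fun j => ?_
  have hj := hσ j
  have hi' := (hσ i).2 hi
  simp only [Finset.mem_filter, Finset.mem_Ico, Finset.mem_Icc,
    Equiv.Perm.coe_inv, Equiv.symm_apply_apply] at *
  omega

/-- The first `q` positions are always `(q-1)`-st almost left-to-right minima. -/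
theorem card_DelQ_add_card_Icc {q : ℕ} (hq : 0 < q) (m : ℕ) (σ : Equiv.Perm ℕ) :
    (DelQ q m σ).card + ((Finset.Icc 1 m).filter fun i => i ≤ q).card =
      ((Finset.Icc 1 m).filter fun i =>
        ((Finset.Ico 1 i).filter fun j => σ j < σ i).card ≤ q - 1).card := by
  rw [DelQ, ← Finset.card_union_of_disjoint]
  · congr 1
    ext i
    have h := Finset.card_filter_le (Finset.Ico 1 i) fun j => σ j < σ i
    rw [Nat.card_Ico] at h
    simp only [Finset.mem_union, Finset.mem_filter, Finset.mem_Icc]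
    omega
  · rw [Finset.disjoint_left]
    intro i
    simp only [Finset.mem_filter, Finset.mem_Icc]
    omega

theorem card_DelQ_inv_of_mapsTo {q m : ℕ} (hq : 0 < q) {σ : Equiv.Perm ℕ}
    (hσ : ∀ i, σ i ∈ Finset.Icc 1 m ↔ i ∈ Finset.Icc 1 m) :
    (DelQ q m σ).card = (DelQ q m σ⁻¹).card := by
  refine Nat.add_right_cancel (m := ((Finset.Icc 1 m).filter fun i => i ≤ q).card) ?_
  rw [card_DelQ_add_card_Icc hq, card_DelQ_add_card_Icc hq]
  refine Finset.card_equiv σ fun i => ?_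
  simp only [Finset.mem_filter, hσ i]
  refine and_congr_right fun hi => ?_
  rw [card_filter_lt_inv hσ hi]

theorem natPerm_mem_Icc {m : ℕ} (π : Equiv.Perm (Fin m)) (i : ℕ) :
    natPerm π i ∈ Finset.Icc 1 m ↔ i ∈ Finset.Icc 1 m := by
  by_cases hi : i ∈ Finset.Icc 1 m
  · rw [natPerm, Equiv.Perm.extendDomain_apply_subtype _ _ hi]
    exact iff_of_true (Subtype.property _) hi
  · rw [natPerm, Equiv.Perm.extendDomain_apply_not_subtype _ _ hi]

/-- For every positive integer `q` and every permutation `π` of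
`{1,…,n+q-1}`, the number of `a^{q-1}.l.t.r.min` of `π` equals the number of
`a^{q-1}.l.t.r.min` of `π⁻¹`: `#Del_q(π) = #Del_q(π⁻¹)`. -/
theorem card_DelQ_inv (q n : ℕ) (hq : 0 < q) (π : Equiv.Perm (Fin (n + q - 1))) :
    (DelQ q (n + q - 1) (natPerm π)).card = (DelQ q (n + q - 1) (natPerm π⁻¹)).card := by
  have h : natPerm π⁻¹ = (natPerm π)⁻¹ := (Equiv.Perm.extendDomain_inv π _).symm
  rw [h]
  exact card_DelQ_inv_of_mapsTo hq (natPerm_mem_Icc π)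
end

section
/- For every positive integer q and every integer n ≥ 0, the number of permutations of {1,…,n+q−1} avoiding Pat(q) equals (q−1)! times the n-th q-Bell number: h_q(n+q−1) = (q−1)! · b_q(n). Equivalently, #{π ∈ S_{n+q−1} : Del_q(π) − 1 = Des_q(π)} = (q−1)! · Σ_k q^k S(n,k). -/
open Finset

/-- The generating function of the set partitions of `s` by number of blocks, evaluated at `q`. -/
def blockSum {α : Type*} [DecidableEq α] (q : ℕ) (s : Finset α) : ℕ :=
  ∑ P : Finpartition s, q ^ P.parts.card

lemma Finpartition.exists_extend_of_insert {α : Type*} [DecidableEq α] {s : Finset α} {a : α}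
    (ha : a ∉ s) (P : Finpartition (insert a s)) :
    ∃ t ⊆ s, ∃ Q : Finpartition t, P.parts = insert (insert a s \ t) Q.parts := by
  obtain ⟨b, hb, hab⟩ := P.exists_mem (mem_insert_self a s)
  have hbs : b ⊆ insert a s := P.le hb
  have hsup : (P.parts.erase b).sup id = insert a s \ b := by
    ext x
    simp only [mem_sup, mem_erase, id, mem_sdiff]
    constructor
    · rintro ⟨c, ⟨hcb, hc⟩, hx⟩
      exact ⟨P.le hc hx, fun hxb => hcb (P.eq_of_mem_parts hc hb hx hxb)⟩
    · rintro ⟨hx, hxb⟩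
      obtain ⟨c, hc, hxc⟩ := P.exists_mem hx
      exact ⟨c, ⟨fun h => hxb (h ▸ hxc), hc⟩, hxc⟩
  refine ⟨insert a s \ b, ?_, P.ofSubset (erase_subset b _) hsup, ?_⟩
  · intro x hx
    simp only [mem_sdiff, mem_insert] at hx
    rcases hx with ⟨rfl | h, hxb⟩
    · exact absurd hab hxb
    · exact h
  · rw [Finset.sdiff_sdiff_eq_self hbs]
    exact (insert_erase hb).symm

lemma blockSum_insert {α : Type*} [DecidableEq α] (q : ℕ) {s : Finset α} {a : α} (ha : a ∉ s) :
    blockSum q (insert a s) = q * ∑ t ∈ s.powerset, blockSum q t := by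
  have hblock : ∀ t ⊆ s, a ∈ insert a s \ t := fun t ht =>
    mem_sdiff.2 ⟨mem_insert_self a s, fun h => ha (ht h)⟩
  have hnot : ∀ t ⊆ s, ∀ Q : Finpartition t, insert a s \ t ∉ Q.parts := fun t ht Q h =>
    ha (ht (Q.le h (hblock t ht)))
  unfold blockSum
  rw [mul_sum, Finset.sum_congr rfl fun t _ => mul_sum _ _ q,
    Finset.sum_sigma' (s.powerset) (fun t => (univ : Finset (Finpartition t)))
      (fun t Q => q * q ^ Q.parts.card)]
  symm
  refine Finset.sum_bij (fun x hx => x.2.extend (b := insert a s \ x.1) (c := insert a s)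
    (Finset.nonempty_iff_ne_empty.1 ⟨a, hblock _ (mem_powerset.1 (mem_sigma.1 hx).1)⟩)
    disjoint_sdiff (sup_sdiff_cancel_right
      ((mem_powerset.1 (mem_sigma.1 hx).1).trans (subset_insert a s)))) ?_ ?_ ?_ ?_
  · exact fun _ _ => mem_univ _
  · rintro ⟨t, Q⟩ hx ⟨t', Q'⟩ hx' h
    have ht : t ⊆ s := mem_powerset.1 (mem_sigma.1 hx).1
    have ht' : t' ⊆ s := mem_powerset.1 (mem_sigma.1 hx').1
    have hp : insert (insert a s \ t) Q.parts = insert (insert a s \ t') Q'.parts :=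
      congrArg Finpartition.parts h
    have hb : insert a s \ t = insert a s \ t' := by
      have hm := hp ▸ mem_insert_self (insert a s \ t) Q.parts
      rcases mem_insert.1 hm with h | h
      · exact h
      · exact absurd (ht' (Q'.le h (hblock t ht))) ha
    obtain rfl : t = t' := by
      rw [← Finset.sdiff_sdiff_eq_self (ht.trans (subset_insert a s)), hb,
        Finset.sdiff_sdiff_eq_self (ht'.trans (subset_insert a s))]
    have hQ : Q = Q' := by
      ext1
      rw [← erase_insert (hnot t ht Q), hp, erase_insert (hnot t ht Q')]
    rw [hQ]
  · intro P _
    obtain ⟨t, ht, Q, hP⟩ := P.exists_extend_of_insert ha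
    exact ⟨⟨t, Q⟩, mem_sigma.2 ⟨mem_powerset.2 ht, mem_univ _⟩, Finpartition.ext hP.symm⟩
  · rintro ⟨t, Q⟩ _
    rw [Finpartition.card_extend, pow_succ']

lemma qBell_eq_blockSum (q n : ℕ) : qBell q n = blockSum q (univ : Finset (Fin n)) := by
  unfold qBell blockSum stirling2
  have hmaps : ∀ P ∈ (univ : Finset (Finpartition (univ : Finset (Fin n)))),
      P.parts.card ∈ range (n + 1) := fun P _ => by
    simpa [Nat.lt_succ_iff] using P.card_parts_le_card
  rw [← sum_fiberwise_of_maps_to hmaps]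
  refine sum_congr rfl fun k _ => ?_
  rw [sum_congr rfl (g := fun _ => q ^ k) fun P hP => by rw [(mem_filter.1 hP).2], sum_const,
    smul_eq_mul, mul_comm, Nat.card_eq_fintype_card, Fintype.card_subtype]

/-- Sequences satisfying the binomial recurrence of the `q`-Bell numbers are multiples of them. -/
lemma eq_mul_blockSum_of_recurrence {α : Type*} [DecidableEq α] {q : ℕ} {g : ℕ → ℕ}
    (hg : ∀ n, g (n + 1) = q * ∑ j ∈ range (n + 1), n.choose j * g j) (s : Finset α) :
    g s.card = g 0 * blockSum q s := by
  induction s using Finset.strongInduction with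
  | H s ih =>
    rcases s.eq_empty_or_nonempty with rfl | ⟨a, has⟩
    · have : blockSum q (∅ : Finset α) = 1 := by
        have : Unique (Finpartition (∅ : Finset α)) :=
          inferInstanceAs (Unique (Finpartition (⊥ : Finset α)))
        rw [blockSum, Fintype.sum_unique, Finpartition.parts_eq_empty_iff.2 rfl, card_empty,
          pow_zero]
      simp [this]
    · obtain ⟨s, ha, rfl⟩ : ∃ t, a ∉ t ∧ insert a t = s :=
        ⟨s.erase a, notMem_erase a s, insert_erase has⟩
      have hsum : ∑ t ∈ s.powerset, g t.card = g 0 * ∑ t ∈ s.powerset, blockSum q t := by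
        rw [mul_sum]
        exact sum_congr rfl fun t ht =>
          ih t ((mem_powerset.1 ht).trans_ssubset (ssubset_insert ha))
      rw [card_insert_of_notMem ha, hg, blockSum_insert q ha, mul_left_comm, ← hsum,
        sum_powerset_apply_card]
      simp

/-- The condition on `π` equivalent to avoiding `Pat(q)`: every descent bottom is greater than
fewer than `q` earlier values. -/
def DescentBottomsSmall (q : ℕ) {m : ℕ} (π : Equiv.Perm (Fin m)) : Prop :=
  ∀ i j : Fin m, i.val + 1 = j.val → π j < π i → (univ.filter fun k => k < j ∧ π k < π j).card < q

/-- The permutation of `{0,…,m}` with last value `v` whose other values are in the same relative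
order as those of `σ`. -/
def appendValue {m : ℕ} (v : Fin (m + 1)) (σ : Equiv.Perm (Fin m)) : Equiv.Perm (Fin (m + 1)) :=
  finSuccEquivLast.trans ((Equiv.optionCongr σ).trans (finSuccEquiv' v).symm)

@[simp]
lemma appendValue_last {m : ℕ} (v : Fin (m + 1)) (σ : Equiv.Perm (Fin m)) :
    appendValue v σ (Fin.last m) = v := by
  simp [appendValue]

@[simp]
lemma appendValue_castSucc {m : ℕ} (v : Fin (m + 1)) (σ : Equiv.Perm (Fin m)) (i : Fin m) :
    appendValue v σ i.castSucc = v.succAbove (σ i) := by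
  simp [appendValue]

lemma appendValue_bijective (m : ℕ) :
    Function.Bijective fun x : Fin (m + 1) × Equiv.Perm (Fin m) => appendValue x.1 x.2 := by
  rw [Fintype.bijective_iff_injective_and_card]
  constructor
  · rintro ⟨v, σ⟩ ⟨v', σ'⟩ h
    have h' : appendValue v σ = appendValue v' σ' := h
    obtain rfl : v = v' := by
      rw [← appendValue_last v σ, h', appendValue_last]
    have hσ : σ = σ' := by
      ext1 i
      apply Fin.succAbove_right_injective (p := v)
      rw [← appendValue_castSucc, h', appendValue_castSucc]
    rw [hσ]
  · simp [Fintype.card_perm, Nat.factorial_succ]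

lemma card_filter_castSucc_lt {m : ℕ} (p : Fin (m + 1) → Prop) [DecidablePred p] (j : Fin m) :
    (univ.filter fun k : Fin (m + 1) => k < j.castSucc ∧ p k).card =
      (univ.filter fun k : Fin m => k < j ∧ p k.castSucc).card := by
  rw [← card_map (s := univ.filter fun k : Fin m => _) Fin.castSuccEmb]
  refine congrArg card (Finset.ext fun k => ?_)
  refine Fin.lastCases ?_ (fun k => ?_) k
  · simp [Fin.castSucc_ne_last, (Fin.castSucc_lt_last j).le]
  · simp

lemma card_filter_lt_last {m : ℕ} (v : Fin (m + 1)) (σ : Equiv.Perm (Fin m)) :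
    (univ.filter fun k => k < Fin.last m ∧ appendValue v σ k < v).card = v.val := by
  rw [← Fin.card_Iio v, ← card_map (appendValue v σ).toEmbedding]
  congr 1
  ext x
  simp only [mem_map, mem_filter, mem_univ, true_and, Equiv.coe_toEmbedding, mem_Iio]
  constructor
  · rintro ⟨k, ⟨_, hk⟩, rfl⟩
    exact hk
  · intro hx
    refine ⟨(appendValue v σ).symm x, ⟨?_, by simpa using hx⟩, by simp⟩
    refine lt_of_le_of_ne (Fin.le_last _) fun h => ?_
    rw [Equiv.symm_apply_eq, appendValue_last] at h
    exact hx.ne h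

lemma descentBottomsSmall_appendValue {q m : ℕ} (v : Fin (m + 1)) (σ : Equiv.Perm (Fin m)) :
    DescentBottomsSmall q (appendValue v σ) ↔
      DescentBottomsSmall q σ ∧ ∀ i : Fin m, i.val + 1 = m → v.val ≤ (σ i).val → v.val < q := by
  unfold DescentBottomsSmall
  constructor
  · intro h
    constructor
    · intro i j hij hlt
      have := h i.castSucc j.castSucc (by simpa using hij) (by simpa using hlt)
      rw [card_filter_castSucc_lt] at this
      simpa using this
    · intro i hi hv
      have := h i.castSucc (Fin.last m) (by simpa using hi)
        (by simpa [Fin.lt_succAbove_iff_le_castSucc, Fin.le_def] using hv)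
      rw [appendValue_last, card_filter_lt_last] at this
      exact this
  · rintro ⟨h, hv⟩ i j
    refine Fin.lastCases ?_ (fun i => ?_) i
    · intro hij
      have := j.isLt
      simp only [Fin.val_last] at hij
      omega
    refine Fin.lastCases ?_ (fun j => ?_) j
    · intro hi hlt
      rw [appendValue_last, card_filter_lt_last]
      refine hv i (by simpa using hi) ?_
      simpa [Fin.lt_succAbove_iff_le_castSucc, Fin.le_def] using hlt
    · intro hij hlt
      rw [card_filter_castSucc_lt]
      simpa using h i j (by simpa using hij) (by simpa using hlt)

/-- The number of permutations all of whose descent bottoms are small. -/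
noncomputable def smallCount (q m : ℕ) : ℕ :=
  Nat.card {π : Equiv.Perm (Fin m) // DescentBottomsSmall q π}

/-- The number of permutations of `{0,…,m}` with last value `v` all of whose descent bottoms are
small. -/
noncomputable def smallCountLast (q m v : ℕ) : ℕ :=
  Nat.card {π : Equiv.Perm (Fin (m + 1)) // DescentBottomsSmall q π ∧ (π (Fin.last m)).val = v}

lemma Nat.card_eq_sum_card_fiber {α : Type*} [Finite α] (p : α → Prop) (f : α → ℕ) (n : ℕ) :
    Nat.card {x // p x ∧ f x < n} = ∑ u ∈ range n, Nat.card {x // p x ∧ f x = u} := by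
  classical
  have := Fintype.ofFinite α
  simp only [Nat.card_eq_fintype_card, Fintype.card_subtype]
  rw [card_eq_sum_card_fiberwise (f := f) (t := range n) (by intro x; simp)]
  refine sum_congr rfl fun u hu => ?_
  congr 1
  ext x
  have := mem_range.1 hu
  simp only [mem_filter, mem_univ, true_and]
  constructor
  · rintro ⟨⟨h, _⟩, h'⟩
    exact ⟨h, h'⟩
  · rintro ⟨h, h'⟩
    exact ⟨⟨h, by omega⟩, h'⟩

lemma smallCount_succ (q m : ℕ) :
    smallCount q (m + 1) = ∑ u ∈ range (m + 1), smallCountLast q m u := by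
  unfold smallCountLast smallCount
  rw [← Nat.card_eq_sum_card_fiber]
  simp only [Fin.is_lt, and_true]

lemma smallCountLast_eq (q m : ℕ) (v : Fin (m + 1)) :
    smallCountLast q m v.val = Nat.card {σ : Equiv.Perm (Fin m) // DescentBottomsSmall q σ ∧
      ∀ i : Fin m, i.val + 1 = m → v.val ≤ (σ i).val → v.val < q} := by
  symm
  refine Nat.card_eq_of_bijective (fun σ => ⟨appendValue v σ.1,
    (descentBottomsSmall_appendValue v σ.1).2 σ.2, by simp⟩) ⟨?_, ?_⟩
  · rintro ⟨σ, hσ⟩ ⟨σ', hσ'⟩ h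
    have h1 := (appendValue_bijective m).1 (a₁ := (v, σ)) (a₂ := (v, σ')) (congrArg Subtype.val h)
    simpa using h1
  · rintro ⟨π, hπ, hlast⟩
    obtain ⟨⟨w, σ⟩, rfl⟩ := (appendValue_bijective m).2 π
    obtain rfl : w = v := by simpa [Fin.ext_iff] using hlast
    exact ⟨⟨σ, (descentBottomsSmall_appendValue w σ).1 hπ⟩, rfl⟩

lemma smallCountLast_of_lt {q m v : ℕ} (hv : v < q) (hm : v ≤ m) :
    smallCountLast q m v = smallCount q m := by
  rw [smallCountLast_eq q m ⟨v, by omega⟩]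
  simp [hv, smallCount]

lemma smallCountLast_of_le {q m v : ℕ} (hv : q ≤ v) (hm : v ≤ m + 1) :
    smallCountLast q (m + 1) v = ∑ u ∈ range v, smallCountLast q m u := by
  rw [smallCountLast_eq q (m + 1) ⟨v, by omega⟩]
  unfold smallCountLast
  rw [← Nat.card_eq_sum_card_fiber]
  refine Nat.card_congr (Equiv.subtypeEquivRight fun σ => and_congr_right fun _ => ?_)
  constructor
  · intro h
    by_contra hlt
    have := h (Fin.last m) (by simp) (not_lt.1 hlt)
    simp only at this
    omega
  · intro h i hi hle
    obtain rfl : i = Fin.last m := Fin.ext (by simpa using hi)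
    simp only at hle
    omega

lemma smallCount_of_le {q m : ℕ} (hm : m ≤ q) : smallCount q m = m.factorial := by
  induction m with
  | zero =>
    have : ∀ π : Equiv.Perm (Fin 0), DescentBottomsSmall q π := fun π i => i.elim0
    simp [smallCount, this]
  | succ m ih =>
    rw [smallCount_succ, sum_congr rfl fun u hu => smallCountLast_of_lt (m := m)
      ((mem_range.1 hu).trans_le hm) (Nat.lt_succ_iff.1 (mem_range.1 hu))]
    simp [ih (by omega), Nat.factorial_succ]

lemma sum_smallCountLast (p w k : ℕ) :
    ∑ u ∈ range (p + 1 + w), smallCountLast (p + 1) (p + (w + k)) u =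
      (p + 1) * ∑ j ∈ range (w + 1), w.choose j * smallCount (p + 1) (p + (k + j)) := by
  induction w generalizing k with
  | zero =>
    rw [sum_congr rfl fun u hu => smallCountLast_of_lt (m := p + (0 + k))
      (by simpa using hu) (by have := mem_range.1 hu; omega)]
    simp
  | succ w ih =>
    rw [← add_assoc, sum_range_succ, show p + (w + 1 + k) = p + (w + k) + 1 by ring,
      smallCountLast_of_le (by omega) (by omega), ih k,
      show p + (w + k) + 1 = p + (w + (k + 1)) by ring, ih (k + 1)]
    have := sum_choose_succ_mul (R := ℕ) (fun i _ => smallCount (p + 1) (p + (k + i))) w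
    simp only [Nat.cast_id] at this
    rw [this, ← mul_add,
      add_comm (∑ x ∈ range (w + 1), w.choose x * smallCount (p + 1) (p + (k + x)))]
    simp only [add_assoc, add_comm 1]

lemma smallCount_recurrence (p n : ℕ) :
    smallCount (p + 1) (p + (n + 1)) =
      (p + 1) * ∑ j ∈ range (n + 1), n.choose j * smallCount (p + 1) (p + j) := by
  have := sum_smallCountLast p n 0
  simp only [add_zero, zero_add] at this
  rw [← this, ← add_assoc, smallCount_succ, add_right_comm]

lemma natPerm_apply {m : ℕ} (π : Equiv.Perm (Fin m)) (i : Fin m) :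
    natPerm π (i.val + 1) = (π i).val + 1 :=
  Equiv.Perm.extendDomain_apply_image π (finIccEquiv m) i

lemma exists_fin_of_mem_Icc {m a : ℕ} (h1 : 1 ≤ a) (h2 : a ≤ m) : ∃ i : Fin m, a = i.val + 1 :=
  ⟨⟨a - 1, by omega⟩, by simp; omega⟩

lemma card_filter_natPerm_lt {m : ℕ} (π : Equiv.Perm (Fin m)) (j : Fin m) :
    ((Ico 1 (j.val + 1)).filter fun k => natPerm π k < natPerm π (j.val + 1)).card =
      (univ.filter fun k => k < j ∧ π k < π j).card := by
  symm
  refine card_bij (fun k _ => k.val + 1) ?_ ?_ ?_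
  · intro k hk
    simpa [natPerm_apply] using hk
  · intro a _ b _ h
    exact Fin.ext (by simpa using h)
  · intro b hb
    simp only [mem_filter, mem_Ico] at hb
    obtain ⟨i, rfl⟩ := exists_fin_of_mem_Icc (m := m) hb.1.1 (by omega)
    exact ⟨i, by simpa [natPerm_apply] using hb, rfl⟩

lemma descentBottomsSmall_iff_natPerm {q m : ℕ} (π : Equiv.Perm (Fin m)) :
    DescentBottomsSmall q π ↔ ∀ p, 1 ≤ p → p < m → natPerm π (p + 1) < natPerm π p →
      ((Ico 1 (p + 1)).filter fun k => natPerm π k < natPerm π (p + 1)).card < q := by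
  constructor
  · intro h p hp hpm hlt
    obtain ⟨i, rfl⟩ := exists_fin_of_mem_Icc hp hpm.le
    have hj := natPerm_apply π ⟨i.val + 1, hpm⟩
    have hc := card_filter_natPerm_lt π ⟨i.val + 1, hpm⟩
    rw [hc]
    refine h i _ rfl ?_
    rw [hj, natPerm_apply] at hlt
    simpa using hlt
  · intro h i j hij hlt
    have := h (i.val + 1) (by omega) (by omega)
    rw [natPerm_apply π i, hij, card_filter_natPerm_lt, natPerm_apply] at this
    exact this (by simpa using hlt)

lemma avoidsPat_iff {q m : ℕ} (π : Equiv.Perm ℕ) :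
    AvoidsPat q m π ↔ ∀ p, 1 ≤ p → p < m → π (p + 1) < π p →
      ((Ico 1 (p + 1)).filter fun k => π k < π (p + 1)).card < q := by
  unfold AvoidsPat
  constructor
  · intro h p hp hpm hlt
    by_contra hq
    refine h ?_
    set S := (Ico 1 (p + 1)).filter fun k => π k < π (p + 1) with hS
    let e := S.orderEmbOfCardLe (not_lt.1 hq)
    have he : ∀ a, 1 ≤ e a ∧ e a < p ∧ π (e a) < π (p + 1) := by
      intro a
      have hmem : e a ∈ S := S.orderEmbOfCardLe_mem (not_lt.1 hq) a
      simp only [hS, mem_filter, mem_Ico] at hmem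
      refine ⟨hmem.1.1, lt_of_le_of_ne (by omega) fun h => ?_, hmem.2⟩
      rw [h] at hmem
      omega
    refine ⟨Fin.snoc (α := fun _ => ℕ) e p, ?_, ?_, by simpa using hpm, by simpa using hlt, ?_⟩
    · intro a b
      refine Fin.lastCases ?_ (fun b => ?_) b
      · refine Fin.lastCases ?_ (fun a => ?_) a
        · simp
        · intro _
          simpa using (he a).2.1
      · refine Fin.lastCases ?_ (fun a => ?_) a
        · intro hab
          exact absurd hab (not_lt.2 (Fin.le_last _))
        · intro hab
          simpa using hab
    · refine Fin.lastCases ?_ (fun a => ?_) (0 : Fin (q + 1))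
      · simpa using hp
      · simpa using (he a).1
    · intro a
      refine Fin.lastCases ?_ (fun a => ?_) a
      · simp
      · intro _
        simpa using (he a).2.2
  · rintro h ⟨f, hf, h0, hlast, hdes, hsmall⟩
    have hpos : ∀ a, 1 ≤ f a := fun a => h0.trans (hf.monotone (Fin.zero_le a))
    refine absurd (h _ (hpos _) hlast hdes) (not_lt.2 ?_)
    calc q = (univ.map ((Fin.castSuccEmb).trans ⟨f, hf.injective⟩)).card := by simp
      _ ≤ _ := card_le_card fun x hx => by
        simp only [mem_map, mem_univ, true_and, Function.Embedding.trans_apply] at hx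
        obtain ⟨a, rfl⟩ := hx
        have := hf (Fin.castSucc_lt_last a)
        simp only [Function.Embedding.coeFn_mk, Fin.coe_castSuccEmb, mem_filter, mem_Ico]
        exact ⟨⟨hpos _, by omega⟩, hsmall _ (Fin.castSucc_lt_last a).ne⟩

lemma image_delQ_eq_desQ_iff {q m : ℕ} (hq : 0 < q) (π : Equiv.Perm ℕ) :
    (DelQ q m π).image (fun i => i - 1) = DesQ q m π ↔ AvoidsPat q m π := by
  have hmem : ∀ p, p ∈ (DelQ q m π).image (fun i => i - 1) ↔ q ≤ p ∧ p < m ∧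
      ((Ico 1 (p + 1)).filter fun k => π k < π (p + 1)).card < q := by
    intro p
    simp only [DelQ, mem_image, mem_filter, mem_Icc]
    constructor
    · rintro ⟨i, ⟨⟨h1, h2⟩, h3⟩, rfl⟩
      rw [Nat.sub_add_cancel (by omega)]
      omega
    · rintro ⟨h1, h2, h3⟩
      exact ⟨p + 1, ⟨by omega, by omega⟩, by simp⟩
  rw [avoidsPat_iff, DesQ, eq_comm, union_eq_right]
  constructor
  · intro h p hp hpm hlt
    rcases lt_or_ge p q with hpq | hpq
    · have hsub : (Ico 1 (p + 1)).filter (fun k => π k < π (p + 1)) ⊆ Ico 1 (p + 1) :=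
        filter_subset _ _
      have := card_le_card hsub
      rw [Nat.card_Ico] at this
      omega
    · refine ((hmem p).1 (h ?_)).2.2
      simp only [DesSet, mem_inter, mem_filter, mem_Icc]
      omega
  · intro h p hp
    simp only [DesSet, mem_inter, mem_filter, mem_Icc] at hp
    exact (hmem p).2 ⟨by omega, by omega, h p (by omega) (by omega) hp.1.2⟩

lemma hq_eq_smallCount (q m : ℕ) : hq q m = smallCount q m :=
  Nat.card_congr (Equiv.subtypeEquivRight fun π => by
    rw [avoidsPat_iff, descentBottomsSmall_iff_natPerm])

/-- For every positive integer `q` and every integer `n ≥ 0`, the number of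
permutations of `{1,…,n+q-1}` avoiding `Pat(q)` equals `(q-1)!` times the `n`-th `q`-Bell
number: `h_q(n+q-1) = (q-1)! · b_q(n)`. Equivalently,
`#{π ∈ S_{n+q-1} : Del_q(π) - 1 = Des_q(π)} = (q-1)! · Σ_k q^k S(n,k)`. -/
theorem hq_eq_qBell (q n : ℕ) (hq' : 0 < q) :
    hq q (n + q - 1) = Nat.factorial (q - 1) * qBell q n ∧
    {π : Equiv.Perm (Fin (n + q - 1)) |
        (DelQ q (n + q - 1) (natPerm π)).image (fun i => i - 1) =
          DesQ q (n + q - 1) (natPerm π)}.ncard =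
      Nat.factorial (q - 1) * ∑ k ∈ Finset.range (n + 1), q ^ k * stirling2 n k := by 
  have hmain : hq q (n + q - 1) = Nat.factorial (q - 1) * qBell q n := by
    obtain ⟨p, rfl⟩ : ∃ p, q = p + 1 := ⟨q - 1, by omega⟩
    have h := eq_mul_blockSum_of_recurrence
      (g := fun n => smallCount (p + 1) (p + n)) (smallCount_recurrence p) (univ : Finset (Fin n))
    rw [card_univ, Fintype.card_fin, add_zero, smallCount_of_le (Nat.le_succ p)] at h
    rw [hq_eq_smallCount, qBell_eq_blockSum, show n + (p + 1) - 1 = p + n by omega, h]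
    rfl
  refine ⟨hmain, ?_⟩
  simp only [image_delQ_eq_desQ_iff hq']
  exact hmain
end
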